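/- (Coercivity and compact superlevel sets of the inner loop.) Let K ∈ 𝒦. Then the function L ↦ G(K,L) is anti-coercive: G(K,L) → −∞ as ‖L‖_F = (Σ_{t=0}^{N−1} ‖L_t‖_F²)^{1/2} → ∞ (i.e., for every M ∈ ℝ there is R > 0 such that ‖L‖_F ≥ R implies G(K,L) ≤ M); consequently, for every a ∈ ℝ the superlevel set ℒ_K(a) := { L : G(K,L) ≥ a } is a compact subset of (ℝ^{n×m})^N. -/

import Mathlib

open Matrix

noncomputable section

/-- Rayleigh-quotient value set of a square real matrix. -/
def rayleighSet {a : ℕ} (M : Matrix (Fin a) (Fin a) ℝ) : Set ℝ :=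
  { r : ℝ | ∃ x : Fin a → ℝ, x ⬝ᵥ x = 1 ∧ r = x ⬝ᵥ M.mulVec x }

/-- Smallest eigenvalue (of a symmetric matrix), via the Rayleigh characterization. -/
def eigMin {a : ℕ} (M : Matrix (Fin a) (Fin a) ℝ) : ℝ := sInf (rayleighSet M)

/-- Largest eigenvalue (of a symmetric matrix), via the Rayleigh characterization. -/
def eigMax {a : ℕ} (M : Matrix (Fin a) (Fin a) ℝ) : ℝ := sSup (rayleighSet M)

/-- Operator (spectral) norm of a real matrix. -/
def opNorm {a b : ℕ} (M : Matrix (Fin a) (Fin b) ℝ) : ℝ := Real.sqrt (eigMax (Mᵀ * M))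

/-- Squared Frobenius norm. -/
def frobNormSq {a b : ℕ} (M : Matrix (Fin a) (Fin b) ℝ) : ℝ := ∑ i, ∑ j, (M i j) ^ 2

/-- Frobenius norm. -/
def frobNorm {a b : ℕ} (M : Matrix (Fin a) (Fin b) ℝ) : ℝ := Real.sqrt (frobNormSq M)

/-- Extend a finite tuple to a function on `ℕ` by zero. -/
def padZero {α : Type*} [Zero α] {N : ℕ} (f : Fin N → α) : ℕ → α :=
  fun t => if h : t < N then f ⟨t, h⟩ else 0

/-- Data of a finite-horizon zero-sum LQ dynamic game with horizon `N`. -/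
structure LQGame (m d n N : ℕ) where
  A : ℕ → Matrix (Fin m) (Fin m) ℝ
  B : ℕ → Matrix (Fin m) (Fin d) ℝ
  D : ℕ → Matrix (Fin m) (Fin n) ℝ
  Q : ℕ → Matrix (Fin m) (Fin m) ℝ
  QN : Matrix (Fin m) (Fin m) ℝ
  Ru : ℕ → Matrix (Fin d) (Fin d) ℝ
  Rw : ℕ → Matrix (Fin n) (Fin n) ℝ
  Sig : ℕ → Matrix (Fin m) (Fin m) ℝ
  hQ : ∀ t < N, (Q t).PosSemidef
  hQN : QN.PosSemidef
  hRu : ∀ t < N, (Ru t).PosDef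
  hRw : ∀ t < N, (Rw t).PosDef
  hSig : ∀ t ≤ N, (Sig t).PosDef

namespace LQGame

variable {m d n N : ℕ}

/-- Value matrices `P^{K,L}` indexed by the number `j` of steps before the terminal
time, i.e. `PKLaux g K L j = P^{K,L}_{N-j}`. -/
def PKLaux (g : LQGame m d n N) (K : ℕ → Matrix (Fin d) (Fin m) ℝ)
    (L : ℕ → Matrix (Fin n) (Fin m) ℝ) : ℕ → Matrix (Fin m) (Fin m) ℝ
  | 0 => g.QN
  | j + 1 =>
      (g.A (N - (j+1)) - g.B (N - (j+1)) * K (N - (j+1)) - g.D (N - (j+1)) * L (N - (j+1)))ᵀ *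
          PKLaux g K L j *
          (g.A (N - (j+1)) - g.B (N - (j+1)) * K (N - (j+1)) - g.D (N - (j+1)) * L (N - (j+1)))
        + g.Q (N - (j+1)) + (K (N - (j+1)))ᵀ * g.Ru (N - (j+1)) * K (N - (j+1))
        - (L (N - (j+1)))ᵀ * g.Rw (N - (j+1)) * L (N - (j+1))

/-- Value matrix `P^{K,L}_t`. -/
def PKL (g : LQGame m d n N) (K : ℕ → Matrix (Fin d) (Fin m) ℝ)
    (L : ℕ → Matrix (Fin n) (Fin m) ℝ) (t : ℕ) : Matrix (Fin m) (Fin m) ℝ :=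
  PKLaux g K L (N - t)

/-- Inner-loop Riccati matrices indexed by the number `j` of steps before the terminal
time, i.e. `PKaux g K j = P^K_{N-j}`. -/
def PKaux (g : LQGame m d n N) (K : ℕ → Matrix (Fin d) (Fin m) ℝ) :
    ℕ → Matrix (Fin m) (Fin m) ℝ
  | 0 => g.QN
  | j + 1 =>
      g.Q (N - (j+1)) + (K (N - (j+1)))ᵀ * g.Ru (N - (j+1)) * K (N - (j+1))
        + (g.A (N - (j+1)) - g.B (N - (j+1)) * K (N - (j+1)))ᵀ *
          (PKaux g K j + PKaux g K j * g.D (N - (j+1)) *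
            (g.Rw (N - (j+1)) - (g.D (N - (j+1)))ᵀ * PKaux g K j * g.D (N - (j+1)))⁻¹ *
            (g.D (N - (j+1)))ᵀ * PKaux g K j) *
          (g.A (N - (j+1)) - g.B (N - (j+1)) * K (N - (j+1)))

/-- Inner-loop Riccati matrix `P^K_t`. -/
def PK (g : LQGame m d n N) (K : ℕ → Matrix (Fin d) (Fin m) ℝ) (t : ℕ) :
    Matrix (Fin m) (Fin m) ℝ :=
  PKaux g K (N - t)

/-- `P̃^K_{t+1}`. -/
def Ptilde (g : LQGame m d n N) (K : ℕ → Matrix (Fin d) (Fin m) ℝ) (t : ℕ) :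
    Matrix (Fin m) (Fin m) ℝ :=
  g.PK K (t+1) + g.PK K (t+1) * g.D t *
    (g.Rw t - (g.D t)ᵀ * g.PK K (t+1) * g.D t)⁻¹ * (g.D t)ᵀ * g.PK K (t+1)

/-- `K ∈ 𝒦`. -/
def Admissible (g : LQGame m d n N) (K : ℕ → Matrix (Fin d) (Fin m) ℝ) : Prop :=
  ∀ t < N, (g.Rw t - (g.D t)ᵀ * g.PK K (t+1) * g.D t).PosDef

/-- The inner maximizer `L(K)`. -/
def Lopt (g : LQGame m d n N) (K : ℕ → Matrix (Fin d) (Fin m) ℝ) (t : ℕ) :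
    Matrix (Fin n) (Fin m) ℝ :=
  (-(g.Rw t) + (g.D t)ᵀ * g.PK K (t+1) * g.D t)⁻¹ *
    ((g.D t)ᵀ * g.PK K (t+1) * (g.A t - g.B t * K t))

/-- State covariances `X^{K,L}_t`. -/
def Xcov (g : LQGame m d n N) (K : ℕ → Matrix (Fin d) (Fin m) ℝ)
    (L : ℕ → Matrix (Fin n) (Fin m) ℝ) : ℕ → Matrix (Fin m) (Fin m) ℝ
  | 0 => g.Sig 0
  | t + 1 =>
      (g.A t - g.B t * K t - g.D t * L t) * Xcov g K L t *
        (g.A t - g.B t * K t - g.D t * L t)ᵀ + g.Sig (t+1)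

/-- The game value `G(K,L)`. -/
def value (g : LQGame m d n N) (K : ℕ → Matrix (Fin d) (Fin m) ℝ)
    (L : ℕ → Matrix (Fin n) (Fin m) ℝ) : ℝ :=
  ∑ t ∈ Finset.range (N+1), ((g.PKL K L t) * g.Sig t).trace

/-- `E^{K,L}_t`. -/
def Emat (g : LQGame m d n N) (K : ℕ → Matrix (Fin d) (Fin m) ℝ)
    (L : ℕ → Matrix (Fin n) (Fin m) ℝ) (t : ℕ) : Matrix (Fin n) (Fin m) ℝ :=
  (-(g.Rw t) + (g.D t)ᵀ * g.PKL K L (t+1) * g.D t) * L t -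
    (g.D t)ᵀ * g.PKL K L (t+1) * (g.A t - g.B t * K t)

/-- `H^{K,L}_t`. -/
def Hmat (g : LQGame m d n N) (K : ℕ → Matrix (Fin d) (Fin m) ℝ)
    (L : ℕ → Matrix (Fin n) (Fin m) ℝ) (t : ℕ) : Matrix (Fin n) (Fin n) ℝ :=
  g.Rw t - (g.D t)ᵀ * g.PKL K L (t+1) * g.D t

/-- `F^K_t`. -/
def Fmat (g : LQGame m d n N) (K : ℕ → Matrix (Fin d) (Fin m) ℝ) (t : ℕ) :
    Matrix (Fin d) (Fin m) ℝ :=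
  (g.Ru t + (g.B t)ᵀ * g.Ptilde K t * g.B t) * K t - (g.B t)ᵀ * g.Ptilde K t * g.A t

/-- `G^K_t`. -/
def Gmat (g : LQGame m d n N) (K : ℕ → Matrix (Fin d) (Fin m) ℝ) (t : ℕ) :
    Matrix (Fin d) (Fin d) ℝ :=
  g.Ru t + (g.B t)ᵀ * g.Ptilde K t * g.B t

/-- Game Riccati recursion `P*` indexed by steps before terminal time. -/
def Pstaraux (g : LQGame m d n N) : ℕ → Matrix (Fin m) (Fin m) ℝ
  | 0 => g.QN
  | j + 1 =>
      g.Q (N - (j+1)) + (g.A (N - (j+1)))ᵀ * Pstaraux g j *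
        (1 + (g.B (N - (j+1)) * (g.Ru (N - (j+1)))⁻¹ * (g.B (N - (j+1)))ᵀ
            - g.D (N - (j+1)) * (g.Rw (N - (j+1)))⁻¹ * (g.D (N - (j+1)))ᵀ) * Pstaraux g j)⁻¹ *
        g.A (N - (j+1))

/-- `P*_t`. -/
def Pstar (g : LQGame m d n N) (t : ℕ) : Matrix (Fin m) (Fin m) ℝ :=
  Pstaraux g (N - t)

/-- `Λ_t` of the game Riccati recursion. -/
def LambdaStar (g : LQGame m d n N) (t : ℕ) : Matrix (Fin m) (Fin m) ℝ :=
  1 + (g.B t * (g.Ru t)⁻¹ * (g.B t)ᵀ - g.D t * (g.Rw t)⁻¹ * (g.D t)ᵀ) * g.Pstar (t+1)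

/-- Assumption 2.4. -/
def Assumption24 (g : LQGame m d n N) : Prop :=
  (∀ t < N, IsUnit (g.LambdaStar t)) ∧ (∀ t ≤ N, (g.Pstar t).PosSemidef) ∧
    (∀ t < N, (g.Rw t - (g.D t)ᵀ * g.Pstar (t+1) * g.D t).PosDef)

/-- `φ := min_{0 ≤ t ≤ N} λ_min(Σ⁰_t)`. -/
def phi (g : LQGame m d n N) : ℝ :=
  (Finset.range (N+1)).inf' (Finset.nonempty_range_iff.mpr (Nat.succ_ne_zero N))
    (fun t => eigMin (g.Sig t))

end LQGame

open scoped MatrixOrder in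
/-- A positive definite matrix dominates a positive multiple of the identity. -/
theorem Matrix.PosDef.exists_pos_posSemidef_sub_smul_one {a : ℕ} {H : Matrix (Fin a) (Fin a) ℝ}
    (hH : H.PosDef) : ∃ c : ℝ, 0 < c ∧ (H - c • (1 : Matrix (Fin a) (Fin a) ℝ)).PosSemidef := by
  rcases subsingleton_or_nontrivial (Matrix (Fin a) (Fin a) ℝ) with _ | _
  · exact ⟨1, one_pos, by rw [Subsingleton.elim (H - _) 0]; exact .zero⟩
  obtain ⟨c, hc, h⟩ := (CFC.exists_pos_algebraMap_le_iff hH.isHermitian.isSelfAdjoint).2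
    (fun x hx => (Matrix.isStrictlyPositive_iff_posDef.2 hH).spectrum_pos hx)
  exact ⟨c, hc, by simpa [Matrix.le_iff, Algebra.algebraMap_eq_smul_one] using h⟩

open scoped MatrixOrder in
theorem Matrix.PosSemidef.trace_mul_nonneg {a : ℕ} {X Y : Matrix (Fin a) (Fin a) ℝ}
    (hX : X.PosSemidef) (hY : Y.PosSemidef) : 0 ≤ (X * Y).trace := by
  obtain ⟨S, rfl⟩ := CStarAlgebra.nonneg_iff_eq_star_mul_self.1 hY.nonneg
  rw [← Matrix.mul_assoc, Matrix.trace_mul_comm, ← Matrix.mul_assoc]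
  exact (hX.mul_mul_conjTranspose_same S).trace_nonneg

theorem frobNormSq_eq_trace {a b : ℕ} (M : Matrix (Fin a) (Fin b) ℝ) :
    frobNormSq M = (M * Mᵀ).trace := by
  simp [frobNormSq, Matrix.trace, Matrix.mul_apply, sq]

theorem frobNormSq_nonneg {a b : ℕ} (M : Matrix (Fin a) (Fin b) ℝ) : 0 ≤ frobNormSq M :=
  Finset.sum_nonneg fun _ _ => Finset.sum_nonneg fun _ _ => sq_nonneg _

theorem sq_apply_le_frobNormSq {a b : ℕ} (M : Matrix (Fin a) (Fin b) ℝ) (i : Fin a) (j : Fin b) :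
    M i j ^ 2 ≤ frobNormSq M :=
  (Finset.single_le_sum (f := fun j => M i j ^ 2) (fun _ _ => sq_nonneg _)
    (Finset.mem_univ j)).trans
    (Finset.single_le_sum (f := fun i => ∑ j, M i j ^ 2)
      (fun _ _ => Finset.sum_nonneg fun _ _ => sq_nonneg _) (Finset.mem_univ i))

theorem frobNormSq_le_two_mul_sub_add {a b : ℕ} (M M' : Matrix (Fin a) (Fin b) ℝ) :
    frobNormSq M ≤ 2 * frobNormSq (M - M') + 2 * frobNormSq M' := by
  simp only [frobNormSq, Finset.mul_sum, ← Finset.sum_add_distrib]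
  refine Finset.sum_le_sum fun i _ => Finset.sum_le_sum fun j _ => ?_
  rw [Matrix.sub_apply]
  nlinarith [sq_nonneg (M i j - 2 * M' i j)]

/-- The quadratic form `M ↦ Tr(Mᵀ H M S)` is coercive for positive definite `H` and `S`. -/
theorem exists_pos_mul_frobNormSq_le_trace {a b : ℕ} {H : Matrix (Fin a) (Fin a) ℝ}
    {S : Matrix (Fin b) (Fin b) ℝ} (hH : H.PosDef) (hS : S.PosDef) :
    ∃ c : ℝ, 0 < c ∧ ∀ M : Matrix (Fin a) (Fin b) ℝ,
      c * frobNormSq M ≤ (Mᵀ * H * M * S).trace := by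
  obtain ⟨h, h0, hh⟩ := hH.exists_pos_posSemidef_sub_smul_one
  obtain ⟨s, s0, hs⟩ := hS.exists_pos_posSemidef_sub_smul_one
  refine ⟨h * s, mul_pos h0 s0, fun M => ?_⟩
  have h1 := (hh.conjTranspose_mul_mul_same M).trace_mul_nonneg hS.posSemidef
  have h2 := (hs.mul_mul_conjTranspose_same M).trace_nonneg
  have h3 : (Mᵀ * M * S).trace = (M * S * Mᵀ).trace := by
    rw [Matrix.mul_assoc, Matrix.trace_mul_comm]
  simp only [Matrix.conjTranspose_eq_transpose_of_trivial, Matrix.mul_sub, Matrix.sub_mul,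
    Matrix.mul_smul, Matrix.smul_mul, Matrix.mul_one, Matrix.trace_sub, Matrix.trace_smul,
    smul_eq_mul] at h1 h2
  rw [frobNormSq_eq_trace]
  rw [h3] at h1
  nlinarith

/-- Completion of the square in the maximizer gain. -/
theorem riccati_sub_eq_square {m n : ℕ} {P C : Matrix (Fin m) (Fin m) ℝ}
    {D : Matrix (Fin m) (Fin n) ℝ} {R : Matrix (Fin n) (Fin n) ℝ} (hP : Pᵀ = P)
    (hH : (R - Dᵀ * P * D).PosDef) (L : Matrix (Fin n) (Fin m) ℝ) :
    Cᵀ * (P + P * D * (R - Dᵀ * P * D)⁻¹ * Dᵀ * P) * C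
        - ((C - D * L)ᵀ * P * (C - D * L) - Lᵀ * R * L) =
      (L - (-R + Dᵀ * P * D)⁻¹ * (Dᵀ * P * C))ᵀ * (R - Dᵀ * P * D) *
        (L - (-R + Dᵀ * P * D)⁻¹ * (Dᵀ * P * C)) := by
  have hHt : (R - Dᵀ * P * D)ᵀ = R - Dᵀ * P * D := hH.isHermitian
  have hdet := (Matrix.isUnit_iff_isUnit_det _).1 hH.isUnit
  have hneg : -R + Dᵀ * P * D = -(R - Dᵀ * P * D) := by abel
  obtain ⟨Z, hZ⟩ : ∃ Z, Z = (R - Dᵀ * P * D)⁻¹ * (Dᵀ * P * C) := ⟨_, rfl⟩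
  have hinv : (-R + Dᵀ * P * D)⁻¹ * (Dᵀ * P * C) = -Z := by
    rw [hneg, hZ, ← Matrix.neg_mul, Matrix.inv_eq_left_inv (B := -(R - Dᵀ * P * D)⁻¹)]
    rw [neg_mul_neg, Matrix.nonsing_inv_mul _ hdet]
  have hHZ : (R - Dᵀ * P * D) * Z = Dᵀ * P * C := by
    rw [hZ, ← Matrix.mul_assoc, Matrix.mul_nonsing_inv _ hdet, Matrix.one_mul]
  have hZH : Zᵀ * (R - Dᵀ * P * D) = Cᵀ * P * D := by
    have := congrArg Matrix.transpose hHZ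
    rwa [Matrix.transpose_mul, hHt, Matrix.transpose_mul, Matrix.transpose_mul, hP,
      Matrix.transpose_transpose, ← Matrix.mul_assoc] at this
  have hcenter : Cᵀ * (P + P * D * (R - Dᵀ * P * D)⁻¹ * Dᵀ * P) * C =
      Cᵀ * P * C + Cᵀ * P * D * Z := by
    rw [hZ]; simp only [Matrix.mul_add, Matrix.add_mul, Matrix.mul_assoc]
  rw [hinv, hcenter, sub_neg_eq_add, Matrix.transpose_add, Matrix.add_mul, Matrix.mul_add,
    hZH, Matrix.add_mul, Matrix.add_mul, Matrix.mul_assoc Lᵀ _ Z, hHZ]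
  simp only [Matrix.transpose_sub, Matrix.transpose_mul, Matrix.mul_sub, Matrix.sub_mul,
    Matrix.mul_assoc]
  abel

namespace LQGame

variable {m d n N : ℕ}

theorem PKL_last (g : LQGame m d n N) (K : ℕ → Matrix (Fin d) (Fin m) ℝ)
    (L : ℕ → Matrix (Fin n) (Fin m) ℝ) : g.PKL K L N = g.QN := by
  simp [PKL, PKLaux]

theorem PK_last (g : LQGame m d n N) (K : ℕ → Matrix (Fin d) (Fin m) ℝ) :
    g.PK K N = g.QN := by
  simp [PK, PKaux]

theorem PKL_step (g : LQGame m d n N) (K : ℕ → Matrix (Fin d) (Fin m) ℝ)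
    (L : ℕ → Matrix (Fin n) (Fin m) ℝ) {t : ℕ} (ht : t < N) :
    g.PKL K L t = (g.A t - g.B t * K t - g.D t * L t)ᵀ * g.PKL K L (t + 1) *
        (g.A t - g.B t * K t - g.D t * L t) + g.Q t + (K t)ᵀ * g.Ru t * K t
          - (L t)ᵀ * g.Rw t * L t := by
  have h1 : N - t = N - (t + 1) + 1 := by omega
  have h2 : N - (N - (t + 1) + 1) = t := by omega
  rw [PKL, h1, PKLaux, h2, PKL]

theorem PK_step (g : LQGame m d n N) (K : ℕ → Matrix (Fin d) (Fin m) ℝ) {t : ℕ} (ht : t < N) :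
    g.PK K t = g.Q t + (K t)ᵀ * g.Ru t * K t +
      (g.A t - g.B t * K t)ᵀ * g.Ptilde K t * (g.A t - g.B t * K t) := by
  have h1 : N - t = N - (t + 1) + 1 := by omega
  have h2 : N - (N - (t + 1) + 1) = t := by omega
  rw [PK, h1, PKaux, h2, Ptilde, PK]

theorem PK_transpose (g : LQGame m d n N) {K : ℕ → Matrix (Fin d) (Fin m) ℝ}
    (hK : g.Admissible K) {t : ℕ} (ht : t ≤ N) : (g.PK K t)ᵀ = g.PK K t := by
  induction ht using Nat.decreasingInduction with
  | self => rw [PK_last]; exact g.hQN.isHermitian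
  | of_succ t ht ih =>
    have hQ : (g.Q t)ᵀ = g.Q t := (g.hQ t ht).isHermitian
    have hR : (g.Ru t)ᵀ = g.Ru t := (g.hRu t ht).isHermitian
    have hH : ((g.Rw t - (g.D t)ᵀ * g.PK K (t + 1) * g.D t)⁻¹)ᵀ =
        (g.Rw t - (g.D t)ᵀ * g.PK K (t + 1) * g.D t)⁻¹ := (hK t ht).isHermitian.inv
    rw [g.PK_step K ht, Ptilde]
    simp only [Matrix.transpose_add, Matrix.transpose_mul, Matrix.transpose_transpose, hQ, hR, hH,
      ih]
    simp only [Matrix.mul_assoc]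

/-- The gap between the inner-loop Riccati matrix and the value matrix of a gain `L`. -/
theorem PK_sub_PKL_step (g : LQGame m d n N) {K : ℕ → Matrix (Fin d) (Fin m) ℝ}
    (hK : g.Admissible K) (L : ℕ → Matrix (Fin n) (Fin m) ℝ) {t : ℕ} (ht : t < N) :
    g.PK K t - g.PKL K L t =
      (g.A t - g.B t * K t - g.D t * L t)ᵀ * (g.PK K (t + 1) - g.PKL K L (t + 1)) *
          (g.A t - g.B t * K t - g.D t * L t) +
        (L t - g.Lopt K t)ᵀ * (g.Rw t - (g.D t)ᵀ * g.PK K (t + 1) * g.D t) *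
          (L t - g.Lopt K t) := by
  rw [Lopt, ← riccati_sub_eq_square (g.PK_transpose hK ht) (hK t ht), g.PK_step K ht,
    g.PKL_step K L ht, Ptilde,
    Matrix.mul_sub _ (g.PK K (t + 1)), Matrix.sub_mul _ _ (g.A t - g.B t * K t - g.D t * L t)]
  abel

theorem PK_sub_PKL_posSemidef (g : LQGame m d n N) {K : ℕ → Matrix (Fin d) (Fin m) ℝ}
    (hK : g.Admissible K) (L : ℕ → Matrix (Fin n) (Fin m) ℝ) {t : ℕ} (ht : t ≤ N) :
    (g.PK K t - g.PKL K L t).PosSemidef := by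
  induction ht using Nat.decreasingInduction with
  | self => rw [PK_last, PKL_last, sub_self]; exact Matrix.PosSemidef.zero
  | of_succ t ht ih =>
    rw [g.PK_sub_PKL_step hK L ht]
    exact (ih.conjTranspose_mul_mul_same _).add ((hK t ht).posSemidef.conjTranspose_mul_mul_same _)

/-- The inner objective lies below a negative definite quadratic centred at `Lopt`. -/
theorem exists_value_le_sub_frobNormSq (g : LQGame m d n N) (hN : 0 < N)
    {K : ℕ → Matrix (Fin d) (Fin m) ℝ} (hK : g.Admissible K) :
    ∃ c : ℝ, 0 < c ∧ ∀ L : ℕ → Matrix (Fin n) (Fin m) ℝ,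
      g.value K L ≤ ∑ t ∈ Finset.range (N + 1), (g.PK K t * g.Sig t).trace
        - c * ∑ t ∈ Finset.range N, frobNormSq (L t - g.Lopt K t) := by
  have hex : ∀ t, ∃ c : ℝ, 0 < c ∧ (t < N → ∀ M : Matrix (Fin n) (Fin m) ℝ, c * frobNormSq M ≤
      (Mᵀ * (g.Rw t - (g.D t)ᵀ * g.PK K (t + 1) * g.D t) * M * g.Sig t).trace) := by
    intro t
    by_cases ht : t < N
    · obtain ⟨c, hc, h⟩ := exists_pos_mul_frobNormSq_le_trace (hK t ht) (g.hSig t ht.le)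
      exact ⟨c, hc, fun _ => h⟩
    · exact ⟨1, one_pos, fun h => absurd h ht⟩
  choose c hc hle using hex
  have hne : (Finset.range N).Nonempty := Finset.nonempty_range_iff.2 hN.ne'
  refine ⟨(Finset.range N).inf' hne c, (Finset.lt_inf'_iff hne).2 fun t _ => hc t, fun L => ?_⟩
  have hgap : ∀ t ∈ Finset.range N, (Finset.range N).inf' hne c * frobNormSq (L t - g.Lopt K t) ≤
      ((g.PK K t - g.PKL K L t) * g.Sig t).trace := by
    intro t ht
    have htN := Finset.mem_range.1 ht
    refine (mul_le_mul_of_nonneg_right (Finset.inf'_le c ht) (frobNormSq_nonneg _)).trans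
      ((hle t htN _).trans ?_)
    rw [g.PK_sub_PKL_step hK L htN, Matrix.add_mul, Matrix.trace_add]
    exact le_add_of_nonneg_left (((g.PK_sub_PKL_posSemidef hK L htN).conjTranspose_mul_mul_same
      _).trace_mul_nonneg (g.hSig t htN.le).posSemidef)
  have hsum := Finset.sum_le_sum hgap
  simp only [Matrix.sub_mul, Matrix.trace_sub, Finset.sum_sub_distrib] at hsum
  rw [value, Finset.sum_range_succ, Finset.sum_range_succ, PK_last, PKL_last, Finset.mul_sum]
  linarith

theorem exists_forall_value_le (g : LQGame m d n N) (hN : 0 < N)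
    {K : ℕ → Matrix (Fin d) (Fin m) ℝ} (hK : g.Admissible K) (M : ℝ) :
    ∃ R : ℝ, 0 < R ∧ ∀ L : ℕ → Matrix (Fin n) (Fin m) ℝ,
      R ≤ Real.sqrt (∑ t ∈ Finset.range N, frobNormSq (L t)) → g.value K L ≤ M := by
  obtain ⟨c, hc, hval⟩ := g.exists_value_le_sub_frobNormSq hN hK
  set C := ∑ t ∈ Finset.range (N + 1), (g.PK K t * g.Sig t).trace
  set S := ∑ t ∈ Finset.range N, frobNormSq (g.Lopt K t)
  refine ⟨max 1 (2 * (C - M) / c + 2 * S), by positivity, fun L hL => (hval L).trans ?_⟩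
  have hR1 := (le_max_left _ _).trans hL
  have hR2 := (le_max_right _ _).trans hL
  have hsq := Real.sq_sqrt (Finset.sum_nonneg fun t (_ : t ∈ Finset.range N) =>
    frobNormSq_nonneg (L t))
  have hsplit : ∑ t ∈ Finset.range N, frobNormSq (L t) ≤
      2 * ∑ t ∈ Finset.range N, frobNormSq (L t - g.Lopt K t) + 2 * S := by
    simp only [S, Finset.mul_sum, ← Finset.sum_add_distrib]
    exact Finset.sum_le_sum fun t _ => frobNormSq_le_two_mul_sub_add _ _
  have hbound : 2 * (C - M) / c ≤ 2 * ∑ t ∈ Finset.range N, frobNormSq (L t - g.Lopt K t) := by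
    nlinarith
  rw [div_le_iff₀ hc] at hbound
  linarith

theorem continuous_PKLaux (g : LQGame m d n N) (K : ℕ → Matrix (Fin d) (Fin m) ℝ) (j : ℕ) :
    Continuous fun L : ℕ → Matrix (Fin n) (Fin m) ℝ => g.PKLaux K L j := by
  induction j with
  | zero => exact continuous_const
  | succ j ih =>
    simp only [PKLaux]
    fun_prop

theorem continuous_value (g : LQGame m d n N) (K : ℕ → Matrix (Fin d) (Fin m) ℝ) :
    Continuous fun L : ℕ → Matrix (Fin n) (Fin m) ℝ => g.value K L :=
  continuous_finsetSum _ fun t _ =>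
    ((g.continuous_PKLaux K (N - t)).matrix_mul continuous_const).matrix_trace

end LQGame

theorem continuous_padZero {α : Type*} [Zero α] [TopologicalSpace α] {N : ℕ} :
    Continuous (padZero : (Fin N → α) → ℕ → α) := by
  refine continuous_pi fun t => ?_
  by_cases ht : t < N
  · simpa only [padZero, dif_pos ht] using continuous_apply _
  · simpa only [padZero, dif_neg ht] using continuous_const

/-- for admissible `K`, the inner objective `G(K,·)` is anti-coercive and
its superlevel sets are compact. -/
theorem LQGame.inner_anticoercive_compact_superlevel {m d n N : ℕ} (g : LQGame m d n N)
    (hN : 0 < N) (K : ℕ → Matrix (Fin d) (Fin m) ℝ) (hK : g.Admissible K) :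
    (∀ M : ℝ, ∃ R : ℝ, 0 < R ∧ ∀ L : ℕ → Matrix (Fin n) (Fin m) ℝ,
        R ≤ Real.sqrt (∑ t ∈ Finset.range N, frobNormSq (L t)) → g.value K L ≤ M)
    ∧ (∀ a : ℝ,
        IsCompact {LF : Fin N → Matrix (Fin n) (Fin m) ℝ | a ≤ g.value K (padZero LF)}) := by
  refine ⟨g.exists_forall_value_le hN hK, fun a => ?_⟩
  obtain ⟨R, -, hR⟩ := g.exists_forall_value_le hN hK (a - 1)
  have hbox : IsCompact (Set.univ.pi fun _ : Fin N => Set.univ.pi fun _ : Fin n =>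
      Set.univ.pi fun _ : Fin m => Set.Icc (-R) R) :=
    isCompact_univ_pi fun _ => isCompact_univ_pi fun _ => isCompact_univ_pi fun _ => isCompact_Icc
  refine hbox.of_isClosed_subset
    (isClosed_le continuous_const ((g.continuous_value K).comp continuous_padZero)) ?_
  intro LF hLF t _ i _ j _
  have hlt : Real.sqrt (∑ t ∈ Finset.range N, frobNormSq (padZero LF t)) < R := by
    by_contra! h
    have := hR _ h
    have : a ≤ g.value K (padZero LF) := hLF
    linarith
  refine abs_le.1 ((Real.abs_le_sqrt ((sq_apply_le_frobNormSq (LF t) i j).trans ?_)).trans hlt.le)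
  have := Finset.single_le_sum (f := fun t => frobNormSq (padZero LF t))
    (fun _ _ => frobNormSq_nonneg _) (Finset.mem_range.2 t.isLt)
  simpa [padZero] using this
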